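/- The octahedron K_{2,2,2} is common: for every graphon W, m_{K_{2,2,2}}(W) ≥ 2^{-11} = 2^{1-e(K_{2,2,2})}. -/

import Mathlib

open MeasureTheory

/-- Homomorphism density of a single edge `K₂`. -/
noncomputable def tK2 (U : unitInterval → unitInterval → ℝ) : ℝ :=
  ∫ x : Fin 2 → unitInterval, U (x 0) (x 1)

/-- Homomorphism density of the cherry/path `K_{1,2}`. -/
noncomputable def tP3 (U : unitInterval → unitInterval → ℝ) : ℝ :=
  ∫ x : Fin 3 → unitInterval, U (x 0) (x 1) * U (x 1) (x 2)

/-- Homomorphism density of the triangle `K₃`. -/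
noncomputable def tK3 (U : unitInterval → unitInterval → ℝ) : ℝ :=
  ∫ x : Fin 3 → unitInterval, U (x 0) (x 1) * U (x 1) (x 2) * U (x 2) (x 0)

/-- Homomorphism density of the 4-cycle `C₄`. -/
noncomputable def tC4 (U : unitInterval → unitInterval → ℝ) : ℝ :=
  ∫ x : Fin 4 → unitInterval, U (x 0) (x 1) * U (x 1) (x 2) * U (x 2) (x 3) * U (x 3) (x 0)

/-- Homomorphism density of the triangle with a pendant edge `K₃⁺`. -/
noncomputable def tK3p (U : unitInterval → unitInterval → ℝ) : ℝ :=
  ∫ x : Fin 4 → unitInterval, U (x 0) (x 1) * U (x 1) (x 2) * U (x 2) (x 0) * U (x 2) (x 3)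

/-- Homomorphism density of the diamond `D = K_{1,1,2}`. -/
noncomputable def tD (U : unitInterval → unitInterval → ℝ) : ℝ :=
  ∫ x : Fin 4 → unitInterval,
    U (x 0) (x 1) * U (x 0) (x 2) * U (x 0) (x 3) * U (x 1) (x 2) * U (x 1) (x 3)

/-- Homomorphism density of the octahedron `K_{2,2,2}` (parts `{0,1},{2,3},{4,5}`). -/
noncomputable def tK222 (U : unitInterval → unitInterval → ℝ) : ℝ :=
  ∫ x : Fin 6 → unitInterval,
    U (x 0) (x 2) * U (x 0) (x 3) * U (x 0) (x 4) * U (x 0) (x 5) *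
    U (x 1) (x 2) * U (x 1) (x 3) * U (x 1) (x 4) * U (x 1) (x 5) *
    U (x 2) (x 4) * U (x 2) (x 5) * U (x 3) (x 4) * U (x 3) (x 5)

/-- `W` is a graphon: measurable, symmetric, with values in `[0,1]`. -/
def IsGraphon (W : unitInterval → unitInterval → ℝ) : Prop :=
  Measurable (fun p : unitInterval × unitInterval => W p.1 p.2) ∧
    (∀ x y, W x y = W y x) ∧ (∀ x y, 0 ≤ W x y) ∧ (∀ x y, W x y ≤ 1)

/-- The complementary graphon `1 - W`. -/
def compl' (W : unitInterval → unitInterval → ℝ) : unitInterval → unitInterval → ℝ :=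
  fun x y => 1 - W x y

/-- A real-valued function that is measurable and bounded. -/
def IsBddMeas {α : Type*} [MeasurableSpace α] (F : α → ℝ) : Prop :=
  Measurable F ∧ ∃ C, ∀ a, |F a| ≤ C

namespace IsBddMeas

variable {α β : Type*} [MeasurableSpace α] [MeasurableSpace β]

lemma const (c : ℝ) : IsBddMeas (fun _ : α => c) :=
  ⟨measurable_const, |c|, fun _ => le_rfl⟩

lemma add {F G : α → ℝ} (hF : IsBddMeas F) (hG : IsBddMeas G) :
    IsBddMeas (fun a => F a + G a) := by
  obtain ⟨hF, C, hC⟩ := hF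
  obtain ⟨hG, D, hD⟩ := hG
  exact ⟨hF.add hG, C + D, fun a => (abs_add_le _ _).trans (add_le_add (hC a) (hD a))⟩

lemma mul {F G : α → ℝ} (hF : IsBddMeas F) (hG : IsBddMeas G) :
    IsBddMeas (fun a => F a * G a) := by
  obtain ⟨hF, C, hC⟩ := hF
  obtain ⟨hG, D, hD⟩ := hG
  refine ⟨hF.mul hG, C * D, fun a => ?_⟩
  rw [abs_mul]
  exact mul_le_mul (hC a) (hD a) (abs_nonneg _) ((abs_nonneg _).trans (hC a))

lemma comp {F : β → ℝ} (hF : IsBddMeas F) {g : α → β} (hg : Measurable g) :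
    IsBddMeas (fun a => F (g a)) := by
  obtain ⟨hF, C, hC⟩ := hF
  exact ⟨hF.comp hg, C, fun a => hC _⟩

lemma integrable {F : α → ℝ} (hF : IsBddMeas F) (μ : Measure α) [IsFiniteMeasure μ] :
    Integrable F μ := by
  obtain ⟨hF, C, hC⟩ := hF
  exact Integrable.of_bound hF.aestronglyMeasurable C (ae_of_all _ hC)

lemma integral_right {h : α → β → ℝ} (hh : IsBddMeas (Function.uncurry h))
    (μ : Measure β) [IsProbabilityMeasure μ] : IsBddMeas (fun a => ∫ s, h a s ∂μ) := by
  obtain ⟨hm, C, hC⟩ := hh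
  refine ⟨(hm.stronglyMeasurable.integral_prod_right).measurable, C, fun a => ?_⟩
  have := norm_integral_le_of_norm_le_const (μ := μ) (f := h a) (C := C)
    (ae_of_all _ fun s => hC (a, s))
  simpa using this

lemma integral_add {μ : Measure α} [IsFiniteMeasure μ] {F G : α → ℝ}
    (hF : IsBddMeas F) (hG : IsBddMeas G) :
    ∫ a, (F a + G a) ∂μ = ∫ a, F a ∂μ + ∫ a, G a ∂μ :=
  MeasureTheory.integral_add (hF.integrable μ) (hG.integrable μ)

end IsBddMeas

section Pi

variable {α : Type*} [MeasureSpace α] [IsProbabilityMeasure (volume : Measure α)]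

lemma measurePreserving_comp_injective {ι κ : Type*} [Fintype ι] [Fintype κ]
    (σ : ι → κ) (hσ : Function.Injective σ) :
    MeasurePreserving (fun (x : κ → α) (i : ι) => x (σ i)) := by
  classical
  have hm : Measurable (fun (x : κ → α) (i : ι) => x (σ i)) := by fun_prop
  refine ⟨hm, (Measure.pi_eq fun s hs => ?_).symm⟩
  rw [Measure.map_apply hm (MeasurableSet.univ_pi hs)]
  have hpre : (fun (x : κ → α) (i : ι) => x (σ i)) ⁻¹' Set.univ.pi s =
      Set.univ.pi (Function.extend σ s fun _ => Set.univ) := by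
    ext x
    simp only [Set.mem_preimage, Set.mem_pi, Set.mem_univ, forall_const]
    refine ⟨fun h j => ?_, fun h i => by simpa [hσ.extend_apply] using h (σ i)⟩
    by_cases hj : ∃ i, σ i = j
    · obtain ⟨i, rfl⟩ := hj
      simpa [hσ.extend_apply] using h i
    · simp [Function.extend_apply' _ _ _ hj]
  rw [hpre, volume_pi_pi]
  refine (Finset.prod_of_injOn σ hσ.injOn (by simp) (fun j _ hj => ?_) fun i _ => ?_).symm
  · rw [Function.extend_apply' _ _ _ (by simpa using hj)]
    exact measure_univ
  · rw [hσ.extend_apply]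

lemma integral_comp_injective {ι κ : Type*} [Fintype ι] [Fintype κ]
    (σ : ι → κ) (hσ : Function.Injective σ) {F : (ι → α) → ℝ} (hF : IsBddMeas F) :
    ∫ x : κ → α, F (fun i => x (σ i)) = ∫ y, F y := by
  have h := measurePreserving_comp_injective (α := α) σ hσ
  rw [← h.map_eq, integral_map h.measurable.aemeasurable hF.1.aestronglyMeasurable]

lemma integral_fin_succ {k : ℕ} {h : (Fin k → α) → α → ℝ}
    (hh : IsBddMeas (Function.uncurry h)) :
    ∫ x : Fin (k + 1) → α, h (fun i => x i.succ) (x 0) = ∫ v, ∫ s, h v s := by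
  have hp := volume_preserving_piFinSuccAbove (fun _ : Fin (k + 1) => α) 0
  have := hp.integral_comp (MeasurableEquiv.measurableEmbedding _)
    (fun p : α × (Fin k → α) => h p.2 p.1)
  refine this.trans ?_
  have hi : Integrable (fun p : α × (Fin k → α) => h p.2 p.1) (volume.prod volume) :=
    (hh.comp measurable_swap).integrable _
  exact integral_prod_symm _ hi

lemma integral_fin_succ_succ {k : ℕ} {w : (Fin k → α) → ℝ} {h₁ h₂ : (Fin k → α) → α → ℝ}
    (hw : IsBddMeas w) (hh₁ : IsBddMeas (Function.uncurry h₁))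
    (hh₂ : IsBddMeas (Function.uncurry h₂)) :
    ∫ x : Fin (k + 2) → α, w (fun i => x i.succ.succ) *
      h₁ (fun i => x i.succ.succ) (x 0) * h₂ (fun i => x i.succ.succ) (x 1) =
    ∫ v, w v * (∫ s, h₁ v s) * (∫ s, h₂ v s) := by
  have e₁ := integral_fin_succ (k := k + 1) (α := α)
    (h := fun u s => w (fun i => u i.succ) * h₁ (fun i => u i.succ) s *
      h₂ (fun i => u i.succ) (u 0))
    (((hw.comp (g := fun p : (Fin (k + 1) → α) × α => fun i => p.1 i.succ) (by fun_prop)).mul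
      (hh₁.comp (g := fun p : (Fin (k + 1) → α) × α => (fun i => p.1 i.succ, p.2))
        (by fun_prop))).mul
      (hh₂.comp (g := fun p : (Fin (k + 1) → α) × α => (fun i => p.1 i.succ, p.1 0))
        (by fun_prop)))
  refine e₁.trans ?_
  simp only [integral_mul_const, integral_const_mul]
  have e₂ := integral_fin_succ (k := k) (α := α)
    (h := fun v s => w v * (∫ t, h₁ v t) * h₂ v s)
    (((hw.mul (hh₁.integral_right volume)).comp measurable_fst).mul hh₂)
  simpa only [integral_const_mul] using e₂

/-- Cauchy–Schwarz for gluing two copies of a vertex along the remaining variables. -/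
lemma sq_integral_fin_succ_le {k : ℕ} {w : (Fin k → α) → ℝ} {h : (Fin k → α) → α → ℝ}
    (hw : IsBddMeas w) (hw0 : ∀ v, 0 ≤ w v) (hh : IsBddMeas (Function.uncurry h)) :
    (∫ x : Fin (k + 1) → α, w (fun i => x i.succ) * h (fun i => x i.succ) (x 0)) ^ 2 ≤
    (∫ x : Fin (k + 2) → α, w (fun i => x i.succ.succ) *
      h (fun i => x i.succ.succ) (x 0) * h (fun i => x i.succ.succ) (x 1)) * ∫ v, w v := by
  have e := integral_fin_succ (k := k) (α := α) (h := fun v s => w v * h v s)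
    ((hw.comp measurable_fst).mul hh)
  simp only [integral_const_mul] at e
  rw [e, integral_fin_succ_succ hw hh hh]
  have hH := hh.integral_right (volume : Measure α)
  set H := fun v => ∫ s, h v s
  have key : ∀ c : ℝ, 0 ≤ (∫ v, w v) * (c * c) + (-2 * ∫ v, w v * H v) * c +
      ∫ v, w v * H v * H v := by
    intro c
    have : 0 ≤ ∫ v, w v * (H v - c) ^ 2 :=
      integral_nonneg fun v => mul_nonneg (hw0 v) (sq_nonneg _)
    have e : ∀ v, w v * (H v - c) ^ 2 =
        w v * (c * c) + w v * H v * (-2 * c) + w v * H v * H v := fun v => by ring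
    simp only [e] at this
    rw [IsBddMeas.integral_add ((hw.mul (.const _)).add ((hw.mul hH).mul (.const _)))
        ((hw.mul hH).mul hH),
      IsBddMeas.integral_add (hw.mul (.const _)) ((hw.mul hH).mul (.const _)),
      integral_mul_const, integral_mul_const] at this
    linarith
  have := discrim_le_zero key
  unfold discrim at this
  change (∫ v, w v * H v) ^ 2 ≤ (∫ v, w v * H v * H v) * ∫ v, w v
  nlinarith

end Pi

lemma IsBddMeas.edge {β : Type*} [MeasurableSpace β] {U : unitInterval → unitInterval → ℝ}
    (hU : IsBddMeas (Function.uncurry U)) {p q : β → unitInterval}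
    (hp : Measurable p) (hq : Measurable q) : IsBddMeas (fun a => U (p a) (q a)) :=
  hU.comp (g := fun a => (p a, q a)) (hp.prodMk hq)

/-- Homomorphism density of the wheel `K_{1,2,2}` (parts `{0}, {1,2}, {3,4}`). -/
noncomputable def tK122 (U : unitInterval → unitInterval → ℝ) : ℝ :=
  ∫ x : Fin 5 → unitInterval,
    U (x 1) (x 3) * U (x 1) (x 4) * U (x 2) (x 3) * U (x 2) (x 4) *
    (U (x 0) (x 1) * U (x 0) (x 2) * U (x 0) (x 3) * U (x 0) (x 4))

section CauchySchwarz

variable {U : unitInterval → unitInterval → ℝ}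

lemma tK122_sq_le (hU : IsBddMeas (Function.uncurry U)) (hs : ∀ x y, U x y = U y x)
    (h0 : ∀ x y, 0 ≤ U x y) : tK122 U ^ 2 ≤ tK222 U * tC4 U := by
  have key := sq_integral_fin_succ_le (α := unitInterval) (k := 4)
    (w := fun v => U (v 0) (v 2) * U (v 0) (v 3) * U (v 1) (v 2) * U (v 1) (v 3))
    (h := fun v s => U s (v 0) * U s (v 1) * U s (v 2) * U s (v 3))
    (by repeat' first | apply IsBddMeas.mul | apply hU.edge | fun_prop)
    (fun v => by repeat' first | apply mul_nonneg | apply h0)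
    (by
      simp only [Function.uncurry_def]
      repeat' first | apply IsBddMeas.mul | apply hU.edge | fun_prop)
  have hC : tC4 U = ∫ v : Fin 4 → unitInterval,
      U (v 0) (v 2) * U (v 0) (v 3) * U (v 1) (v 2) * U (v 1) (v 3) := by
    unfold tC4
    rw [← integral_comp_injective (α := unitInterval) (![0, 2, 1, 3] : Fin 4 → Fin 4) (by decide)
      (by repeat' first | apply IsBddMeas.mul | apply hU.edge | fun_prop)]
    refine integral_congr_ae (ae_of_all _ fun x => ?_)
    change U (x 0) (x 2) * U (x 2) (x 1) * U (x 1) (x 3) * U (x 3) (x 0) = _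
    dsimp only
    rw [hs (x 2) (x 1), hs (x 3) (x 0)]
    ring
  rw [← hC] at key
  refine key.trans_eq ?_
  congr 1
  refine integral_congr_ae (ae_of_all _ fun x => ?_)
  change U (x 2) (x 4) * U (x 2) (x 5) * U (x 3) (x 4) * U (x 3) (x 5) *
    (U (x 0) (x 2) * U (x 0) (x 3) * U (x 0) (x 4) * U (x 0) (x 5)) *
    (U (x 1) (x 2) * U (x 1) (x 3) * U (x 1) (x 4) * U (x 1) (x 5)) = _
  ring

lemma tD_sq_le (hU : IsBddMeas (Function.uncurry U)) (hs : ∀ x y, U x y = U y x)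
    (h0 : ∀ x y, 0 ≤ U x y) : tD U ^ 2 ≤ tK122 U * tP3 U := by
  have key := sq_integral_fin_succ_le (α := unitInterval) (k := 3)
    (w := fun v => U (v 0) (v 1) * U (v 0) (v 2))
    (h := fun v s => U s (v 0) * U s (v 1) * U s (v 2))
    (by repeat' first | apply IsBddMeas.mul | apply hU.edge | fun_prop)
    (fun v => by repeat' first | apply mul_nonneg | apply h0)
    (by
      simp only [Function.uncurry_def]
      repeat' first | apply IsBddMeas.mul | apply hU.edge | fun_prop)
  have hP : tP3 U = ∫ v : Fin 3 → unitInterval, U (v 0) (v 1) * U (v 0) (v 2) := by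
    unfold tP3
    rw [← integral_comp_injective (α := unitInterval) (![1, 0, 2] : Fin 3 → Fin 3) (by decide)
      (by repeat' first | apply IsBddMeas.mul | apply hU.edge | fun_prop)]
    refine integral_congr_ae (ae_of_all _ fun x => ?_)
    change U (x 1) (x 0) * U (x 0) (x 2) = _
    dsimp only
    rw [hs (x 1) (x 0)]
  have hD : ∫ x : Fin 4 → unitInterval, U (x 1) (x 2) * U (x 1) (x 3) *
      (U (x 0) (x 1) * U (x 0) (x 2) * U (x 0) (x 3)) = tD U := by
    refine integral_congr_ae (ae_of_all _ fun x => ?_)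
    dsimp only
    ring
  have hW : tK122 U = ∫ x : Fin 5 → unitInterval, U (x 2) (x 3) * U (x 2) (x 4) *
      (U (x 0) (x 2) * U (x 0) (x 3) * U (x 0) (x 4)) *
      (U (x 1) (x 2) * U (x 1) (x 3) * U (x 1) (x 4)) := by
    unfold tK122
    rw [← integral_comp_injective (α := unitInterval) (![2, 0, 1, 3, 4] : Fin 5 → Fin 5) (by decide)
      (by repeat' first | apply IsBddMeas.mul | apply hU.edge | fun_prop)]
    refine integral_congr_ae (ae_of_all _ fun x => ?_)
    change U (x 0) (x 3) * U (x 0) (x 4) * U (x 1) (x 3) * U (x 1) (x 4) *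
      (U (x 2) (x 0) * U (x 2) (x 1) * U (x 2) (x 3) * U (x 2) (x 4)) = _
    dsimp only
    rw [hs (x 2) (x 0), hs (x 2) (x 1)]
    ring
  rw [← hP] at key
  rw [← hD, hW]
  exact key

lemma tK3_sq_le (hU : IsBddMeas (Function.uncurry U)) (hs : ∀ x y, U x y = U y x)
    (h0 : ∀ x y, 0 ≤ U x y) : tK3 U ^ 2 ≤ tD U * tK2 U := by
  have key := sq_integral_fin_succ_le (α := unitInterval) (k := 2)
    (w := fun v => U (v 0) (v 1)) (h := fun v s => U s (v 0) * U s (v 1))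
    (by repeat' first | apply IsBddMeas.mul | apply hU.edge | fun_prop)
    (fun v => h0 _ _)
    (by
      simp only [Function.uncurry_def]
      repeat' first | apply IsBddMeas.mul | apply hU.edge | fun_prop)
  have hT : ∫ x : Fin 3 → unitInterval, U (x 1) (x 2) * (U (x 0) (x 1) * U (x 0) (x 2)) =
      tK3 U := by
    refine integral_congr_ae (ae_of_all _ fun x => ?_)
    dsimp only
    rw [hs (x 2) (x 0)]
    ring
  have hD : tD U = ∫ x : Fin 4 → unitInterval, U (x 2) (x 3) * (U (x 0) (x 2) * U (x 0) (x 3)) *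
      (U (x 1) (x 2) * U (x 1) (x 3)) := by
    unfold tD
    rw [← integral_comp_injective (α := unitInterval) (![2, 3, 0, 1] : Fin 4 → Fin 4) (by decide)
      (by repeat' first | apply IsBddMeas.mul | apply hU.edge | fun_prop)]
    refine integral_congr_ae (ae_of_all _ fun x => ?_)
    change U (x 2) (x 3) * U (x 2) (x 0) * U (x 2) (x 1) * U (x 3) (x 0) * U (x 3) (x 1) = _
    dsimp only
    rw [hs (x 2) (x 0), hs (x 2) (x 1), hs (x 3) (x 0), hs (x 3) (x 1)]
    ring
  rw [← hT, hD]
  exact key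

end CauchySchwarz

section SignedKernel

variable {f : unitInterval → unitInterval → ℝ}

lemma tP3_nonneg (hf : IsBddMeas (Function.uncurry f)) (hs : ∀ x y, f x y = f y x) :
    0 ≤ tP3 f := by
  have e := integral_fin_succ_succ (α := unitInterval) (k := 1) (w := fun _ => 1)
    (h₁ := fun v s => f (v 0) s) (h₂ := fun v s => f (v 0) s) (.const _)
    (by simp only [Function.uncurry_def]; apply hf.edge <;> fun_prop)
    (by simp only [Function.uncurry_def]; apply hf.edge <;> fun_prop)
  have h : tP3 f = ∫ x : Fin 3 → unitInterval, 1 * f (x 2) (x 0) * f (x 2) (x 1) := by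
    unfold tP3
    rw [← integral_comp_injective (α := unitInterval) (![0, 2, 1] : Fin 3 → Fin 3) (by decide)
      (by repeat' first | apply IsBddMeas.mul | apply hf.edge | fun_prop)]
    refine integral_congr_ae (ae_of_all _ fun x => ?_)
    change f (x 0) (x 2) * f (x 2) (x 1) = _
    dsimp only
    rw [hs (x 0) (x 2), one_mul]
  rw [h]
  refine e.symm ▸ integral_nonneg fun v => ?_
  simpa using mul_self_nonneg _

lemma integral_two_edges_nonneg (hf : IsBddMeas (Function.uncurry f)) :
    0 ≤ ∫ x : Fin 4 → unitInterval, f (x 0) (x 1) * f (x 2) (x 3) := by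
  have e := integral_fin_succ_succ (α := unitInterval) (k := 2) (w := fun _ => 1)
    (h₁ := fun v s => f (v 0) s) (h₂ := fun v s => f (v 1) s) (.const _)
    (by simp only [Function.uncurry_def]; apply hf.edge <;> fun_prop)
    (by simp only [Function.uncurry_def]; apply hf.edge <;> fun_prop)
  have h : ∫ x : Fin 4 → unitInterval, f (x 0) (x 1) * f (x 2) (x 3) =
      ∫ x : Fin 4 → unitInterval, 1 * f (x 2) (x 0) * f (x 3) (x 1) := by
    rw [← integral_comp_injective (α := unitInterval) (![2, 0, 3, 1] : Fin 4 → Fin 4) (by decide)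
      (by repeat' first | apply IsBddMeas.mul | apply hf.edge | fun_prop)]
    refine integral_congr_ae (ae_of_all _ fun x => ?_)
    change f (x 2) (x 0) * f (x 3) (x 1) = _
    dsimp only
    rw [one_mul]
  rw [h]
  refine e.symm ▸ ?_
  have hp := integral_fintype_prod_eq_prod (ι := Fin 2) (𝕜 := ℝ)
    (fun _ (y : unitInterval) => ∫ s, f y s) (μ := fun _ => volume)
  simp only [Fin.prod_univ_two] at hp
  simp only [one_mul]
  exact hp.symm ▸ mul_self_nonneg _

lemma signed_kernel_ineq (hf : IsBddMeas (Function.uncurry f)) (hs : ∀ x y, f x y = f y x)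
    (h1 : ∀ x y, |f x y| ≤ 1) : 0 ≤ 48 * tP3 f + 5 * tC4 f + 28 * tK3p f := by
  have hd : IsBddMeas (Function.uncurry fun (v : Fin 2 → unitInterval) s => f (v 0) s) := by
    simp only [Function.uncurry_def]; apply hf.edge <;> fun_prop
  have hg : IsBddMeas (Function.uncurry fun (v : Fin 2 → unitInterval) s =>
      f (v 0) s * f (v 1) s) := by
    simp only [Function.uncurry_def]
    repeat' first | apply IsBddMeas.mul | apply hf.edge | fun_prop
  have hw : IsBddMeas (fun v : Fin 2 → unitInterval => f (v 0) (v 1)) := by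
    apply hf.edge <;> fun_prop
  have e₁ := integral_fin_succ_succ (.const 1) hd hd
  have e₂ := integral_fin_succ_succ (.const 1) hg hg
  have e₃ := integral_fin_succ_succ hw hg hd
  have hP : tP3 f = ∫ x : Fin 4 → unitInterval, 1 * f (x 2) (x 0) * f (x 2) (x 1) := by
    unfold tP3
    rw [← integral_comp_injective (α := unitInterval) (![0, 2, 1] : Fin 3 → Fin 4)
      (by decide)
      (by repeat' first | apply IsBddMeas.mul | apply hf.edge | fun_prop)]
    refine integral_congr_ae (ae_of_all _ fun x => ?_)
    change f (x 0) (x 2) * f (x 2) (x 1) = _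
    dsimp only
    rw [hs (x 0) (x 2), one_mul]
  have hC : tC4 f = ∫ x : Fin 4 → unitInterval,
      1 * (f (x 2) (x 0) * f (x 3) (x 0)) * (f (x 2) (x 1) * f (x 3) (x 1)) := by
    unfold tC4
    rw [← integral_comp_injective (α := unitInterval) (![0, 2, 1, 3] : Fin 4 → Fin 4) (by decide)
      (by repeat' first | apply IsBddMeas.mul | apply hf.edge | fun_prop)]
    refine integral_congr_ae (ae_of_all _ fun x => ?_)
    change f (x 0) (x 2) * f (x 2) (x 1) * f (x 1) (x 3) * f (x 3) (x 0) = _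
    dsimp only
    rw [hs (x 0) (x 2), hs (x 1) (x 3)]
    ring
  have hT : tK3p f = ∫ x : Fin 4 → unitInterval,
      f (x 2) (x 3) * (f (x 2) (x 0) * f (x 3) (x 0)) * f (x 2) (x 1) := by
    unfold tK3p
    rw [← integral_comp_injective (α := unitInterval) (![3, 0, 2, 1] : Fin 4 → Fin 4) (by decide)
      (by repeat' first | apply IsBddMeas.mul | apply hf.edge | fun_prop)]
    refine integral_congr_ae (ae_of_all _ fun x => ?_)
    change f (x 3) (x 0) * f (x 0) (x 2) * f (x 2) (x 3) * f (x 2) (x 1) = _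
    dsimp only
    rw [hs (x 0) (x 2)]
    ring
  rw [hP.trans e₁, hC.trans e₂, hT.trans e₃]
  have hD := hd.integral_right (volume : Measure unitInterval)
  have hG := hg.integral_right (volume : Measure unitInterval)
  rw [← integral_const_mul, ← integral_const_mul, ← integral_const_mul,
    ← IsBddMeas.integral_add, ← IsBddMeas.integral_add]
  · refine integral_nonneg fun v => ?_
    dsimp only [Pi.zero_apply]
    generalize (∫ s, f (v 0) s * f (v 1) s) = g
    generalize (∫ s, f (v 0) s) = d
    have h := abs_le.mp (h1 (v 0) (v 1))
    have hsq : f (v 0) (v 1) ^ 2 ≤ 1 := by nlinarith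
    generalize f (v 0) (v 1) = a at hsq
    nlinarith [sq_nonneg (5 * g + 14 * a * d), mul_nonneg (sub_nonneg.2 hsq) (sq_nonneg d),
      sq_nonneg d]
  all_goals
    repeat' first
      | apply IsBddMeas.add | apply IsBddMeas.mul | exact .const _ | exact hD | exact hG
      | exact hw

end SignedKernel

section Expansion

variable {f : unitInterval → unitInterval → ℝ}

lemma integral_cherry (hf : IsBddMeas (Function.uncurry f)) {n : ℕ} (i j k : Fin n)
    (h : Function.Injective ![i, j, k]) :
    ∫ x : Fin n → unitInterval, f (x i) (x j) * f (x j) (x k) = tP3 f :=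
  integral_comp_injective (α := unitInterval) ![i, j, k] h
    (F := fun x => f (x 0) (x 1) * f (x 1) (x 2))
    (by repeat' first | apply IsBddMeas.mul | apply hf.edge | fun_prop)

lemma integral_two_edges (hf : IsBddMeas (Function.uncurry f)) {n : ℕ} (i j k l : Fin n)
    (h : Function.Injective ![i, j, k, l]) :
    ∫ x : Fin n → unitInterval, f (x i) (x j) * f (x k) (x l) =
      ∫ x : Fin 4 → unitInterval, f (x 0) (x 1) * f (x 2) (x 3) :=
  integral_comp_injective (α := unitInterval) ![i, j, k, l] h
    (F := fun x => f (x 0) (x 1) * f (x 2) (x 3))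
    (by repeat' first | apply IsBddMeas.mul | apply hf.edge | fun_prop)

lemma integral_four_cycle (hf : IsBddMeas (Function.uncurry f)) {n : ℕ} (i j k l : Fin n)
    (h : Function.Injective ![i, j, k, l]) :
    ∫ x : Fin n → unitInterval, f (x i) (x j) * f (x j) (x k) * f (x k) (x l) * f (x l) (x i) =
      tC4 f :=
  integral_comp_injective (α := unitInterval) ![i, j, k, l] h
    (F := fun x => f (x 0) (x 1) * f (x 1) (x 2) * f (x 2) (x 3) * f (x 3) (x 0))
    (by repeat' first | apply IsBddMeas.mul | apply hf.edge | fun_prop)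

lemma integral_pendant_triangle (hf : IsBddMeas (Function.uncurry f)) {n : ℕ} (i j k l : Fin n)
    (h : Function.Injective ![i, j, k, l]) :
    ∫ x : Fin n → unitInterval, f (x i) (x j) * f (x j) (x k) * f (x k) (x i) * f (x k) (x l) =
      tK3p f :=
  integral_comp_injective (α := unitInterval) ![i, j, k, l] h
    (F := fun x => f (x 0) (x 1) * f (x 1) (x 2) * f (x 2) (x 0) * f (x 2) (x 3))
    (by repeat' first | apply IsBddMeas.mul | apply hf.edge | fun_prop)

lemma isBddMeas_half_add (hf : IsBddMeas (Function.uncurry f)) (c : ℝ) :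
    IsBddMeas (Function.uncurry fun x y => (1 + c * f x y) / 2) := by
  have h := ((IsBddMeas.const (1 : ℝ)).add ((IsBddMeas.const c).mul hf)).mul (.const (1 / 2))
  convert h using 2 with p
  simp only [Function.uncurry_def]
  ring

lemma tK2_add (hf : IsBddMeas (Function.uncurry f)) :
    tK2 (fun x y => (1 + 1 * f x y) / 2) + tK2 (fun x y => (1 + -1 * f x y) / 2) = 1 := by
  have h := isBddMeas_half_add hf
  unfold tK2
  rw [← IsBddMeas.integral_add]
  · calc _ = ∫ x : Fin 2 → unitInterval, (1 : ℝ) :=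
          integral_congr_ae (ae_of_all _ fun x => by ring)
      _ = 1 := by simp
  · apply (h 1).edge <;> fun_prop
  · apply (h (-1)).edge <;> fun_prop

lemma tP3_add (hf : IsBddMeas (Function.uncurry f)) :
    tP3 (fun x y => (1 + 1 * f x y) / 2) + tP3 (fun x y => (1 + -1 * f x y) / 2) =
      (1 + tP3 f) / 2 := by
  have h := isBddMeas_half_add hf
  conv_lhs => unfold tP3
  rw [← IsBddMeas.integral_add]
  · calc _ = ∫ x : Fin 3 → unitInterval, (1 / 2) * (1 + f (x 0) (x 1) * f (x 1) (x 2)) :=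
          integral_congr_ae (ae_of_all _ fun x => by ring)
      _ = _ := by
        rw [integral_const_mul]
        repeat rw [IsBddMeas.integral_add]
        · rw [integral_cherry hf 0 1 2 (by decide)]
          simp
          ring
        all_goals
          repeat' first
            | apply IsBddMeas.add | apply IsBddMeas.mul | apply IsBddMeas.const | apply hf.edge
            | fun_prop
  · apply IsBddMeas.mul <;> apply (h 1).edge <;> fun_prop
  · apply IsBddMeas.mul <;> apply (h (-1)).edge <;> fun_prop

lemma tK3_add (hf : IsBddMeas (Function.uncurry f)) :
    tK3 (fun x y => (1 + 1 * f x y) / 2) + tK3 (fun x y => (1 + -1 * f x y) / 2) =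
      (1 + 3 * tP3 f) / 4 := by
  have h := isBddMeas_half_add hf
  conv_lhs => unfold tK3
  rw [← IsBddMeas.integral_add]
  · calc _ = ∫ x : Fin 3 → unitInterval, (1 / 4) * (1 + f (x 0) (x 1) * f (x 1) (x 2) +
            f (x 1) (x 2) * f (x 2) (x 0) + f (x 2) (x 0) * f (x 0) (x 1)) :=
          integral_congr_ae (ae_of_all _ fun x => by ring)
      _ = _ := by
        rw [integral_const_mul]
        repeat rw [IsBddMeas.integral_add]
        · rw [integral_cherry hf 0 1 2 (by decide), integral_cherry hf 1 2 0 (by decide),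
            integral_cherry hf 2 0 1 (by decide)]
          simp
          ring
        all_goals
          repeat' first
            | apply IsBddMeas.add | apply IsBddMeas.mul | apply IsBddMeas.const | apply hf.edge
            | fun_prop
  · repeat' first | apply (h 1).edge | apply IsBddMeas.mul | fun_prop
  · repeat' first | apply (h (-1)).edge | apply IsBddMeas.mul | fun_prop

lemma tC4_add (hf : IsBddMeas (Function.uncurry f)) :
    tC4 (fun x y => (1 + 1 * f x y) / 2) + tC4 (fun x y => (1 + -1 * f x y) / 2) =
      (1 + 4 * tP3 f + 2 * (∫ x : Fin 4 → unitInterval, f (x 0) (x 1) * f (x 2) (x 3)) +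
        tC4 f) / 8 := by
  have h := isBddMeas_half_add hf
  conv_lhs => unfold tC4
  rw [← IsBddMeas.integral_add]
  · calc _ = ∫ x : Fin 4 → unitInterval, (1 / 8) * (1 + f (x 0) (x 1) * f (x 1) (x 2) +
            f (x 1) (x 2) * f (x 2) (x 3) + f (x 2) (x 3) * f (x 3) (x 0) +
            f (x 3) (x 0) * f (x 0) (x 1) + f (x 0) (x 1) * f (x 2) (x 3) +
            f (x 1) (x 2) * f (x 3) (x 0) +
            f (x 0) (x 1) * f (x 1) (x 2) * f (x 2) (x 3) * f (x 3) (x 0)) :=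
          integral_congr_ae (ae_of_all _ fun x => by ring)
      _ = _ := by
        rw [integral_const_mul]
        repeat rw [IsBddMeas.integral_add]
        · rw [integral_cherry hf 0 1 2 (by decide), integral_cherry hf 1 2 3 (by decide),
            integral_cherry hf 2 3 0 (by decide), integral_cherry hf 3 0 1 (by decide),
            integral_two_edges hf 1 2 3 0 (by decide), integral_four_cycle hf 0 1 2 3 (by decide)]
          simp
          ring
        all_goals
          repeat' first
            | apply IsBddMeas.add | apply IsBddMeas.mul | apply IsBddMeas.const | apply hf.edge
            | fun_prop
  · repeat' first | apply (h 1).edge | apply IsBddMeas.mul | fun_prop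
  · repeat' first | apply (h (-1)).edge | apply IsBddMeas.mul | fun_prop

lemma tD_add (hf : IsBddMeas (Function.uncurry f)) (hs : ∀ x y, f x y = f y x) :
    tD (fun x y => (1 + 1 * f x y) / 2) + tD (fun x y => (1 + -1 * f x y) / 2) =
      (1 + 8 * tP3 f + 2 * (∫ x : Fin 4 → unitInterval, f (x 0) (x 1) * f (x 2) (x 3)) +
        tC4 f + 4 * tK3p f) / 16 := by
  have h := isBddMeas_half_add hf
  conv_lhs => unfold tD
  rw [← IsBddMeas.integral_add]
  · calc _ = ∫ x : Fin 4 → unitInterval, (1 / 16) * (1 +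
            f (x 1) (x 0) * f (x 0) (x 2) + f (x 1) (x 0) * f (x 0) (x 3) +
            f (x 0) (x 1) * f (x 1) (x 2) + f (x 0) (x 1) * f (x 1) (x 3) +
            f (x 2) (x 0) * f (x 0) (x 3) + f (x 0) (x 2) * f (x 2) (x 1) +
            f (x 0) (x 3) * f (x 3) (x 1) + f (x 2) (x 1) * f (x 1) (x 3) +
            f (x 0) (x 2) * f (x 1) (x 3) + f (x 0) (x 3) * f (x 1) (x 2) +
            f (x 2) (x 0) * f (x 0) (x 3) * f (x 3) (x 1) * f (x 1) (x 2) +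
            f (x 0) (x 2) * f (x 2) (x 1) * f (x 1) (x 0) * f (x 1) (x 3) +
            f (x 0) (x 3) * f (x 3) (x 1) * f (x 1) (x 0) * f (x 1) (x 2) +
            f (x 1) (x 3) * f (x 3) (x 0) * f (x 0) (x 1) * f (x 0) (x 2) +
            f (x 1) (x 2) * f (x 2) (x 0) * f (x 0) (x 1) * f (x 0) (x 3)) :=
          integral_congr_ae (ae_of_all _ fun x => by
            dsimp only
            rw [hs (x 1) (x 0), hs (x 2) (x 0), hs (x 3) (x 0), hs (x 2) (x 1), hs (x 3) (x 1)]
            ring)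
      _ = _ := by
        rw [integral_const_mul]
        repeat rw [IsBddMeas.integral_add]
        · rw [integral_cherry hf 1 0 2 (by decide), integral_cherry hf 1 0 3 (by decide),
            integral_cherry hf 0 1 2 (by decide), integral_cherry hf 0 1 3 (by decide),
            integral_cherry hf 2 0 3 (by decide), integral_cherry hf 0 2 1 (by decide),
            integral_cherry hf 0 3 1 (by decide), integral_cherry hf 2 1 3 (by decide),
            integral_two_edges hf 0 2 1 3 (by decide), integral_two_edges hf 0 3 1 2 (by decide),
            integral_four_cycle hf 2 0 3 1 (by decide),
            integral_pendant_triangle hf 0 2 1 3 (by decide),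
            integral_pendant_triangle hf 0 3 1 2 (by decide),
            integral_pendant_triangle hf 1 3 0 2 (by decide),
            integral_pendant_triangle hf 1 2 0 3 (by decide)]
          simp
          ring
        all_goals
          repeat' first
            | apply IsBddMeas.add | apply IsBddMeas.mul | apply IsBddMeas.const | apply hf.edge
            | fun_prop
  · repeat' first | apply (h 1).edge | apply IsBddMeas.mul | fun_prop
  · repeat' first | apply (h (-1)).edge | apply IsBddMeas.mul | fun_prop

end Expansion

lemma sq_add_le_add_mul_add {a b c a' b' c' : ℝ} (ha : 0 ≤ a) (hb : 0 ≤ b)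
    (ha' : 0 ≤ a') (hb' : 0 ≤ b') (h : c ^ 2 ≤ a * b) (h' : c' ^ 2 ≤ a' * b') :
    (c + c') ^ 2 ≤ (a + a') * (b + b') := by
  have h₁ : (c * c') ^ 2 ≤ (a * b) * (a' * b') := by
    rw [mul_pow]
    exact mul_le_mul h h' (sq_nonneg _) (mul_nonneg ha hb)
  have h₂ : 2 * (c * c') ≤ a * b' + a' * b := by
    refine le_of_abs_le (abs_le_of_sq_le_sq ?_ (by positivity))
    nlinarith [sq_nonneg (a * b' - a' * b)]
  nlinarith

/-- The scalar optimisation behind commonality of the octahedron: `p`, `t`, `d`, `w`, `q`, `k`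
stand for the monochromatic densities of `K_{1,2}`, `K₃`, `D`, `K_{1,2,2}`, `C₄`, `K_{2,2,2}`. -/
lemma le_of_density_ineqs {c p t d w q k : ℝ} (hc : 0 ≤ c) (hk : 0 ≤ k)
    (hp : p = (1 + c) / 2) (ht : t = (1 + 3 * c) / 4) (htd : t ^ 2 ≤ d)
    (hdw : d ^ 2 ≤ w * p) (hwk : w ^ 2 ≤ k * q) (hq : q - 1 / 8 ≤ 7 * (d - 1 / 16)) :
    1 / 2048 ≤ k := by
  subst hp ht
  set s := 16 * d with hs
  have hd : d = s / 16 := by rw [hs]; ring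
  rw [hd] at htd hdw hq
  have hs1 : (1 + 3 * c) ^ 2 ≤ s := by nlinarith
  have hs' : 1 ≤ s := by nlinarith
  have hc2 : (1 + c) ^ 2 ≤ (s + 2) / 3 := by nlinarith
  have hq' : q ≤ (7 * s - 5) / 16 := by linarith
  have h₁ : (s / 16) ^ 4 ≤ w ^ 2 * ((1 + c) ^ 2 / 4) := by
    have := pow_le_pow_left₀ (sq_nonneg _) hdw 2
    calc (s / 16) ^ 4 = ((s / 16) ^ 2) ^ 2 := by ring
      _ ≤ _ := this
      _ = _ := by ring
  have h₂ : w ^ 2 ≤ k * ((7 * s - 5) / 16) := hwk.trans (mul_le_mul_of_nonneg_left hq' hk)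
  have h₃ : (s / 16) ^ 4 ≤ k * ((7 * s - 5) / 16) * ((s + 2) / 12) := by
    refine h₁.trans (mul_le_mul h₂ (by linarith) (by positivity) ?_)
    exact (sq_nonneg w).trans h₂
  have h₄ : (7 * s - 5) * (s + 2) ≤ 6 * s ^ 4 := by
    have : 0 ≤ (s - 1) * (6 * s ^ 3 + 6 * s ^ 2 - s - 10) := by
      apply mul_nonneg (by linarith)
      nlinarith [pow_le_pow_left₀ zero_le_one hs' 3, sq_nonneg (s - 1)]
    nlinarith
  have h₅ : 0 < (7 * s - 5) * (s + 2) := by apply mul_pos <;> linarith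
  by_contra! hlt
  nlinarith [mul_lt_mul_of_pos_right hlt h₅]

/-- The octahedron `K_{2,2,2}` is common: for every graphon `W`,
`m_{K_{2,2,2}}(W) ≥ 2⁻¹¹ = 2^{1 - e(K_{2,2,2})}`. -/
theorem K222_common (W : unitInterval → unitInterval → ℝ) (hW : IsGraphon W) :
    (2 : ℝ) ^ (-11 : ℤ) ≤ tK222 W + tK222 (compl' W) := by
  obtain ⟨hm, hsymm, h0, h1⟩ := hW
  let f := fun x y => 2 * W x y - 1
  have hf : IsBddMeas (Function.uncurry f) := by
    refine ⟨(hm.const_mul 2).sub_const 1, 1, fun p => abs_le.2 ⟨?_, ?_⟩⟩ <;>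
      simp only [Function.uncurry_def, f] <;> linarith [h0 p.1 p.2, h1 p.1 p.2]
  have hfs : ∀ x y, f x y = f y x := fun x y => by simp only [f, hsymm x y]
  have hf1 : ∀ x y, |f x y| ≤ 1 := fun x y =>
    abs_le.2 ⟨by simp only [f]; linarith [h0 x y], by simp only [f]; linarith [h1 x y]⟩
  have eW : W = fun x y => (1 + 1 * f x y) / 2 := by
    funext x y; simp only [f]; ring
  have eV : compl' W = fun x y => (1 + -1 * f x y) / 2 := by
    funext x y; simp only [f, compl']; ring
  have bW : IsBddMeas (Function.uncurry W) := eW ▸ isBddMeas_half_add hf 1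
  have bV : IsBddMeas (Function.uncurry (compl' W)) := eV ▸ isBddMeas_half_add hf (-1)
  have sV : ∀ x y, compl' W x y = compl' W y x := fun x y => by simp only [compl', hsymm x y]
  have pV : ∀ x y, 0 ≤ compl' W x y := fun x y => sub_nonneg.2 (h1 x y)
  have n222 {U} (h : ∀ x y, 0 ≤ U x y) : 0 ≤ tK222 U :=
    integral_nonneg fun x => by repeat' first | apply mul_nonneg | apply h
  have n122 {U} (h : ∀ x y, 0 ≤ U x y) : 0 ≤ tK122 U :=
    integral_nonneg fun x => by repeat' first | apply mul_nonneg | apply h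
  have nD {U} (h : ∀ x y, 0 ≤ U x y) : 0 ≤ tD U :=
    integral_nonneg fun x => by repeat' first | apply mul_nonneg | apply h
  have nC {U} (h : ∀ x y, 0 ≤ U x y) : 0 ≤ tC4 U :=
    integral_nonneg fun x => by repeat' first | apply mul_nonneg | apply h
  have nP {U} (h : ∀ x y, 0 ≤ U x y) : 0 ≤ tP3 U :=
    integral_nonneg fun x => by repeat' first | apply mul_nonneg | apply h
  have nK {U} (h : ∀ x y, 0 ≤ U x y) : 0 ≤ tK2 U := integral_nonneg fun x => h _ _
  have m2 := tK2_add hf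
  have mP := tP3_add hf
  have mT := tK3_add hf
  have mC := tC4_add hf
  have mD := tD_add hf hfs
  rw [← eW, ← eV] at m2 mP mT mC mD
  have hTD := sq_add_le_add_mul_add (nD h0) (nK h0) (nD pV) (nK pV)
    (tK3_sq_le bW hsymm h0) (tK3_sq_le bV sV pV)
  have hDW := sq_add_le_add_mul_add (n122 h0) (nP h0) (n122 pV) (nP pV)
    (tD_sq_le bW hsymm h0) (tD_sq_le bV sV pV)
  have hWK := sq_add_le_add_mul_add (n222 h0) (nC h0) (n222 pV) (nC pV)
    (tK122_sq_le bW hsymm h0) (tK122_sq_le bV sV pV)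
  rw [m2, mul_one] at hTD
  refine le_trans (by norm_num) (le_of_density_ineqs (tP3_nonneg hf hfs)
    (add_nonneg (n222 h0) (n222 pV)) mP mT hTD hDW hWK ?_)
  rw [mC, mD]
  linarith [signed_kernel_ineq hf hfs hf1, integral_two_edges_nonneg hf]
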